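/- Let G be a Carnot group of step r, Ω ⊂ G open, and 1 ≤ p ≤ ∞. If a function u : Ω → ℝ^N belongs to the horizontal Sobolev space S^{k,p}_{loc}(Ω) for every k ∈ ℕ, then u belongs to the usual Euclidean Sobolev space W^{k,p}_{loc}(Ω) for every k ∈ ℕ (identifying G with ℝ^n via exponential coordinates). -/

import Mathlib

open MeasureTheory ENNReal

noncomputable section

/-- The underlying space of a Carnot group in exponential coordinates. -/
abbrev CSpace (n : ℕ) := EuclideanSpace ℝ (Fin n)

/-- The Lie bracket of two vector fields on `CSpace n`. -/
def vbracket {n : ℕ} (F H : CSpace n → CSpace n) : CSpace n → CSpace n :=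
  fun p => fderiv ℝ H p (F p) - fderiv ℝ F p (H p)

/-- Differentiation of a function along a vector field `Z`. -/
def Dvf {n : ℕ} (Z : CSpace n → CSpace n) (f : CSpace n → ℝ) : CSpace n → ℝ :=
  fun p => fderiv ℝ f p (Z p)

/-- A Carnot group of step `r`, realized in exponential coordinates on `ℝⁿ`.
The layers `V^k` of the stratification of the Lie algebra are indexed by
`k = 1, …, r`; `m k` is the dimension of `V^k` (with `m k = 0` for `k = 0` and
`k > r`), and `X k i`, `1 ≤ i ≤ m k`, is a left-invariant basis of `V^k`
(a left-invariant vector field being recorded through its coefficient map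
`CSpace n → CSpace n`). -/
structure CarnotGroup (r n : ℕ) : Type where
  hr : 0 < r
  /-- dimension of the `k`-th layer -/
  m : ℕ → ℕ
  m_zero : ∀ k, k = 0 ∨ r < k → m k = 0
  dim_eq : ∑ k ∈ Finset.range (r + 1), m k = n
  /-- the (smooth) group multiplication -/
  mul : CSpace n → CSpace n → CSpace n
  one : CSpace n
  inv : CSpace n → CSpace n
  smooth_mul : ContDiff ℝ (⊤ : ℕ∞) fun p : CSpace n × CSpace n => mul p.1 p.2
  smooth_inv : ContDiff ℝ (⊤ : ℕ∞) inv
  mul_assoc' : ∀ a b c, mul (mul a b) c = mul a (mul b c)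
  one_mul' : ∀ a, mul one a = a
  mul_one' : ∀ a, mul a one = a
  inv_mul' : ∀ a, mul (inv a) a = one
  /-- the left-invariant basis of the `k`-th layer -/
  X : (k : ℕ) → Fin (m k) → CSpace n → CSpace n
  smooth_X : ∀ k i, ContDiff ℝ (⊤ : ℕ∞) (X k i)
  left_invariant_X : ∀ k i g p, X k i (mul g p) = fderiv ℝ (mul g) p (X k i p)
  /-- all the basis fields together form a basis of the Lie algebra -/
  indep_X : LinearIndependent ℝ fun z : Σ k : Fin (r + 1), Fin (m k.1) => X z.1 z.2 one
  /-- stratification: `[V¹, Vᵏ] ⊆ V^{k+1}` for `1 ≤ k < r` -/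
  bracket_mem : ∀ k, 1 ≤ k → k < r → ∀ (i : Fin (m 1)) (j : Fin (m k)),
    vbracket (X 1 i) (X k j) ∈ Submodule.span ℝ (Set.range (X (k + 1)))
  /-- stratification: `V^{k+1} ⊆ [V¹, Vᵏ]` for `1 ≤ k < r` -/
  bracket_span : ∀ k, 1 ≤ k → k < r →
    Submodule.span ℝ (Set.range (X (k + 1))) ≤
      Submodule.span ℝ (Set.range fun z : Fin (m 1) × Fin (m k) =>
        vbracket (X 1 z.1) (X k z.2))
  /-- `[V¹, Vʳ] = 0`: the last layer is central -/
  bracket_top : ∀ (i : Fin (m 1)) (j : Fin (m r)), vbracket (X 1 i) (X r j) = 0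
  /-- the one-parameter subgroup `t ↦ exp (t X_{k,i})` -/
  expMap : (k : ℕ) → Fin (m k) → ℝ → CSpace n
  expMap_zero : ∀ k i, expMap k i 0 = one
  expMap_flow : ∀ k i p t,
    HasDerivAt (fun s => mul p (expMap k i s)) (X k i (mul p (expMap k i t))) t
  /-- the homogeneous gauge pseudo-distance -/
  gauge : CSpace n → CSpace n → ℝ
  gauge_nonneg : ∀ p q, 0 ≤ gauge p q
  gauge_eq_zero : ∀ p q, gauge p q = 0 ↔ p = q

/-- The `L²` norm (valued in `ℝ≥0∞`) of a function over a set `s`. -/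
def L2 {n : ℕ} (s : Set (CSpace n)) (f : CSpace n → ℝ) : ℝ≥0∞ :=
  eLpNorm f 2 (volume.restrict s)

/-- A test function on `Ω`: smooth with compact support contained in `Ω`. -/
def IsTest {n : ℕ} (Ω : Set (CSpace n)) (φ : CSpace n → ℝ) : Prop :=
  ContDiff ℝ (⊤ : ℕ∞) φ ∧ HasCompactSupport φ ∧ tsupport φ ⊆ Ω

/-- `g` is the weak derivative of `f` along the vector field `Z` on `Ω`
(left-invariant vector fields on a Carnot group are divergence free, so no
divergence term appears in the integration by parts). -/
def IsWeakDerivVF {n : ℕ} (Ω : Set (CSpace n)) (Z : CSpace n → CSpace n)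
    (f g : CSpace n → ℝ) : Prop :=
  ∀ φ, IsTest Ω φ → ∫ p in Ω, g p * φ p = -∫ p in Ω, f p * Dvf Z φ p

/-- `f ∈ L^p_{loc}(Ω)`. -/
def MemLploc {n : ℕ} (p : ℝ≥0∞) (Ω : Set (CSpace n)) (f : CSpace n → ℝ) : Prop :=
  ∀ K, K ⊆ Ω → IsCompact K →
    AEStronglyMeasurable f (volume.restrict K) ∧ eLpNorm f p (volume.restrict K) < ⊤

/-- `f ∈ L²_{loc}(Ω)`. -/
def MemL2loc {n : ℕ} (Ω : Set (CSpace n)) (f : CSpace n → ℝ) : Prop :=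
  MemLploc 2 Ω f

namespace CarnotGroup

variable {r n N : ℕ} (G : CarnotGroup r n)

/-- Differentiation along the left-invariant vector field `X_{k,i}`. -/
def D (k : ℕ) (i : Fin (G.m k)) (f : CSpace n → ℝ) : CSpace n → ℝ :=
  fun p => fderiv ℝ f p (G.X k i p)

/-- Iterated differentiation within the single layer `V^k`; the list records
the directions in order of application (head applied first, i.e. innermost). -/
def Dlayer (k : ℕ) (L : List (Fin (G.m k))) (f : CSpace n → ℝ) : CSpace n → ℝ :=
  L.foldl (fun g i => G.D k i g) f

/-- `X^{I_k} X^{I_{k+1}} ⋯ X^{I_r}`: iterated differentiation along layers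
`k, …, r` (the layer-`r` block acting first, the layer-`k` block outermost). -/
def DIfrom (I : (k : ℕ) → List (Fin (G.m k))) (k : ℕ) (f : CSpace n → ℝ) :
    CSpace n → ℝ :=
  (List.range' k (r + 1 - k)).foldr (fun j g => G.Dlayer j (I j) g) f

/-- Iterated differentiation along an arbitrary finite string of
(layer, index) pairs, in order of application. -/
def Dlist (L : List ((k : Fin (r + 1)) × Fin (G.m k.1))) (f : CSpace n → ℝ) :
    CSpace n → ℝ :=
  L.foldl (fun g z => G.D z.1 z.2 g) f

/-- The gauge pseudo-ball. -/
def ball (p₀ : CSpace n) (R : ℝ) : Set (CSpace n) := {p | G.gauge p₀ p < R}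

/-- The homogeneous dimension `Q = ∑ k · m_k`. -/
def homDim : ℕ := ∑ k ∈ Finset.range (r + 1), k * G.m k

/-- `S^{1,2}` norm over `s` of `u`, computed with (weak) horizontal Jacobian `Du`. -/
def S12 (s : Set (CSpace n)) (u : Fin N → CSpace n → ℝ)
    (Du : Fin N → Fin (G.m 1) → CSpace n → ℝ) : ℝ≥0∞ :=
  (∑ β, L2 s (u β)) + ∑ β, ∑ i, L2 s (Du β i)

/-- `S^{1,2}` norm over `s` of a pointwise differentiable function, computed
with classical horizontal derivatives. -/
def S12s (s : Set (CSpace n)) (v : Fin N → CSpace n → ℝ) : ℝ≥0∞ :=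
  (∑ β, L2 s (v β)) + ∑ β, ∑ i, L2 s (G.D 1 i (v β))

/-- `u ∈ S^{1,2}_{loc}(Ω; ℝ^N)`, with weak horizontal Jacobian `Du`. -/
def MemS12loc (Ω : Set (CSpace n)) (u : Fin N → CSpace n → ℝ)
    (Du : Fin N → Fin (G.m 1) → CSpace n → ℝ) : Prop :=
  (∀ β, MemL2loc Ω (u β)) ∧
  (∀ β i, IsWeakDerivVF Ω (G.X 1 i) (u β) (Du β i)) ∧
  (∀ β i, MemL2loc Ω (Du β i))

/-- Coercivity (strong ellipticity along the horizontal directions) of the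
constant coefficients `A` with ellipticity constant `lam`. -/
def Coercive (lam : ℝ) (A : Fin N → Fin N → Fin (G.m 1) → Fin (G.m 1) → ℝ) : Prop :=
  ∀ ξ : Fin N → Fin (G.m 1) → ℝ,
    lam * ∑ α, ∑ i, (ξ α i) ^ 2 ≤ ∑ α, ∑ β, ∑ i, ∑ j, A α β i j * ξ α i * ξ β j

/-- `u` (with weak horizontal Jacobian `Du`) is a weak solution on `Ω` of the
constant coefficient system (1.1):
`∑_β ∑_{i,j} X_i (A_{ij}^{αβ} X_j u^β + f_i^α) = f^α`, `α = 1, …, N`. -/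
def IsWeakSolution (Ω : Set (CSpace n))
    (A : Fin N → Fin N → Fin (G.m 1) → Fin (G.m 1) → ℝ)
    (u : Fin N → CSpace n → ℝ) (Du : Fin N → Fin (G.m 1) → CSpace n → ℝ)
    (f : Fin N → CSpace n → ℝ) (fi : Fin N → Fin (G.m 1) → CSpace n → ℝ) : Prop :=
  ∀ α, ∀ φ, IsTest Ω φ →
    ∑ β, ∑ i, ∑ j, ∫ p in Ω, (A α β i j * Du β j p + fi α i p) * G.D 1 i φ p
      = ∫ p in Ω, f α p * φ p

/-- The sum of the `L²(s)` norms of all iterated derivatives of `f` of order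
at most `M`, along every layer (used to formalize the "collections of higher
order derivatives of the data" `f̃`, `f̃_i`). -/
def dataSum (M : ℕ) (s : Set (CSpace n)) (f : CSpace n → ℝ) : ℝ≥0∞ :=
  ∑ c : Fin M → Option ((k : Fin (r + 1)) × Fin (G.m k.1)),
    L2 s (G.Dlist ((List.finRange M).filterMap c) f)

end CarnotGroup

theorem IsTest.dvf {n : ℕ} {Ω : Set (CSpace n)} {φ : CSpace n → ℝ} (hφ : IsTest Ω φ)
    {Z : CSpace n → CSpace n} (hZ : ContDiff ℝ (⊤ : ℕ∞) Z) : IsTest Ω (Dvf Z φ) := by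
  obtain ⟨h1, h2, h3⟩ := hφ
  have hsub : tsupport (Dvf Z φ) ⊆ tsupport φ := by
    refine closure_minimal (fun x hx => ?_) isClosed_closure
    by_contra hx'
    have : fderiv ℝ φ x = 0 := by
      by_contra h0
      exact hx' (support_fderiv_subset ℝ h0)
    exact hx (by simp [Dvf, this])
  exact ⟨(h1.fderiv_right (by simp)).clm_apply hZ, h2.of_isClosed_subset isClosed_closure hsub,
    hsub.trans h3⟩

theorem IsTest.smooth_mul {n : ℕ} {Ω : Set (CSpace n)} {φ c : CSpace n → ℝ} (hφ : IsTest Ω φ)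
    (hc : ContDiff ℝ (⊤ : ℕ∞) c) : IsTest Ω (fun x => c x * φ x) :=
  ⟨hc.mul hφ.1, hφ.2.1.mul_left, tsupport_mul_subset_right.trans hφ.2.2⟩

theorem contDiff_dvf {n : ℕ} {Z : CSpace n → CSpace n} {c : CSpace n → ℝ}
    (hZ : ContDiff ℝ (⊤ : ℕ∞) Z) (hc : ContDiff ℝ (⊤ : ℕ∞) c) :
    ContDiff ℝ (⊤ : ℕ∞) (Dvf Z c) :=
  (hc.fderiv_right (by simp)).clm_apply hZ

theorem dvf_mul {n : ℕ} (Z : CSpace n → CSpace n) {c φ : CSpace n → ℝ}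
    (hc : ContDiff ℝ (⊤ : ℕ∞) c) (hφ : ContDiff ℝ (⊤ : ℕ∞) φ) (x : CSpace n) :
    Dvf Z (fun y => c y * φ y) x = c x * Dvf Z φ x + Dvf Z c x * φ x := by
  have h1 : DifferentiableAt ℝ c x := hc.differentiable (by simp) x
  have h2 : DifferentiableAt ℝ φ x := hφ.differentiable (by simp) x
  simp only [Dvf]
  rw [fderiv_fun_mul h1 h2]
  simp [mul_comm]

theorem dvf_dvf {n : ℕ} {W : CSpace n → CSpace n} {φ : CSpace n → ℝ}
    (hW : ContDiff ℝ (⊤ : ℕ∞) W) (hφ : ContDiff ℝ (⊤ : ℕ∞) φ) (Z : CSpace n → CSpace n)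
    (x : CSpace n) :
    Dvf Z (Dvf W φ) x =
      fderiv ℝ (fderiv ℝ φ) x (Z x) (W x) + fderiv ℝ φ x (fderiv ℝ W x (Z x)) := by
  have h1 : DifferentiableAt ℝ (fderiv ℝ φ) x :=
    (hφ.fderiv_right (m := (⊤ : ℕ∞)) (by simp)).differentiable (by simp) x
  have h2 : DifferentiableAt ℝ W x := hW.differentiable (by simp) x
  have : fderiv ℝ (fun y => fderiv ℝ φ y (W y)) x = _ := fderiv_clm_apply h1 h2
  change fderiv ℝ (fun y => fderiv ℝ φ y (W y)) x (Z x) = _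
  rw [this]
  simp [add_comm]

/-- The bracket of vector fields is the commutator of the corresponding derivations. -/
theorem dvf_vbracket {n : ℕ} {Z W : CSpace n → CSpace n} {φ : CSpace n → ℝ}
    (hZ : ContDiff ℝ (⊤ : ℕ∞) Z) (hW : ContDiff ℝ (⊤ : ℕ∞) W)
    (hφ : ContDiff ℝ (⊤ : ℕ∞) φ) (x : CSpace n) :
    Dvf (vbracket Z W) φ x = Dvf Z (Dvf W φ) x - Dvf W (Dvf Z φ) x := by
  have hsymm : IsSymmSndFDerivAt ℝ φ x := by
    refine (hφ.contDiffAt (x := x)).isSymmSndFDerivAt ?_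
    simp only [minSmoothness_of_isRCLikeNormedField]
    exact WithTop.coe_le_coe.2 (le_top : (2 : ℕ∞) ≤ ⊤)
  rw [dvf_dvf hW hφ, dvf_dvf hZ hφ, hsymm.eq (Z x) (W x)]
  simp [Dvf, vbracket]

theorem MemLploc.add {n : ℕ} {p : ℝ≥0∞} {Ω : Set (CSpace n)} {f₁ f₂ : CSpace n → ℝ}
    (h₁ : MemLploc p Ω f₁) (h₂ : MemLploc p Ω f₂) :
    MemLploc p Ω (fun x => f₁ x + f₂ x) := fun K hK hc =>
  MemLp.add (show MemLp f₁ p _ from h₁ K hK hc) (show MemLp f₂ p _ from h₂ K hK hc)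

theorem MemLploc.continuous_mul {n : ℕ} {p : ℝ≥0∞} {Ω : Set (CSpace n)} {f c : CSpace n → ℝ}
    (hf : MemLploc p Ω f) (hc : Continuous c) : MemLploc p Ω (fun x => c x * f x) := by
  intro K hK hKc
  obtain ⟨C, hC⟩ := hKc.exists_bound_of_continuousOn hc.continuousOn
  have hc' : MemLp c ⊤ (volume.restrict K) :=
    memLp_top_of_bound hc.aestronglyMeasurable C
      ((ae_restrict_iff' hKc.measurableSet).2 (Filter.Eventually.of_forall hC))
  exact MemLp.mul (show MemLp f p _ from hf K hK hKc) hc'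

theorem MemLploc.integrableOn_mul_test {n : ℕ} {p : ℝ≥0∞} (hp : 1 ≤ p) {Ω : Set (CSpace n)}
    {f φ : CSpace n → ℝ} (hf : MemLploc p Ω f) (hφ : IsTest Ω φ) :
    IntegrableOn (fun x => f x * φ x) Ω := by
  have hK : IsCompact (tsupport φ) := hφ.2.1
  have : IsFiniteMeasure (volume.restrict (tsupport φ)) :=
    ⟨by simpa using hK.measure_lt_top⟩
  have h : MemLp (fun x => φ x * f x) p (volume.restrict (tsupport φ)) :=
    hf.continuous_mul hφ.1.continuous _ hφ.2.2 hK
  have hi : IntegrableOn (fun x => φ x * f x) (tsupport φ) := h.integrable hp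
  have hs : Function.support (fun x => φ x * f x) ⊆ tsupport φ := by
    intro x hx
    exact subset_tsupport φ fun h0 => hx (by simp [h0])
  simpa [mul_comm] using ((integrableOn_iff_integrable_of_support_subset hs).1 hi).integrableOn

/-- The module generated by a set of functions over the ring of smooth functions. -/
inductive SmoothSpan {n : ℕ} (S : Set (CSpace n → ℝ)) : (CSpace n → ℝ) → Prop
  | mem (f : CSpace n → ℝ) : f ∈ S → SmoothSpan S f
  | add (f₁ f₂ : CSpace n → ℝ) : SmoothSpan S f₁ → SmoothSpan S f₂ →
      SmoothSpan S (fun x => f₁ x + f₂ x)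
  | mul (c f : CSpace n → ℝ) : ContDiff ℝ (⊤ : ℕ∞) c → SmoothSpan S f →
      SmoothSpan S (fun x => c x * f x)

theorem SmoothSpan.memLploc {n : ℕ} {S : Set (CSpace n → ℝ)} {p : ℝ≥0∞} {Ω : Set (CSpace n)}
    (hS : ∀ f ∈ S, MemLploc p Ω f) {f : CSpace n → ℝ} (hf : SmoothSpan S f) :
    MemLploc p Ω f := by
  induction hf with
  | mem f h => exact hS f h
  | add _ _ _ _ h₁ h₂ => exact h₁.add h₂
  | mul _ _ hc _ h => exact h.continuous_mul hc.continuous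

theorem SmoothSpan.zero_mul {n : ℕ} {S : Set (CSpace n → ℝ)} {f : CSpace n → ℝ}
    (hf : SmoothSpan S f) : SmoothSpan S (fun _ => 0) := by
  simpa using SmoothSpan.mul (fun _ => 0) f contDiff_const hf

/-- A smooth vector field along which every element of the class `C` has a weak derivative
in `C`. -/
def PreservesVF {n : ℕ} (Ω : Set (CSpace n)) (C : (CSpace n → ℝ) → Prop)
    (Z : CSpace n → CSpace n) : Prop :=
  ContDiff ℝ (⊤ : ℕ∞) Z ∧ ∀ f, C f → ∃ f', C f' ∧ IsWeakDerivVF Ω Z f f'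

section Preserves

variable {n : ℕ} {p : ℝ≥0∞} {Ω : Set (CSpace n)} {S : Set (CSpace n → ℝ)}

theorem IsWeakDerivVF.smooth_mul (hp : 1 ≤ p) {Z : CSpace n → CSpace n}
    (hZ : ContDiff ℝ (⊤ : ℕ∞) Z) {c f f' : CSpace n → ℝ} (hc : ContDiff ℝ (⊤ : ℕ∞) c)
    (hf : MemLploc p Ω f) (hf' : MemLploc p Ω f') (h : IsWeakDerivVF Ω Z f f') :
    IsWeakDerivVF Ω Z (fun x => c x * f x) (fun x => c x * f' x + Dvf Z c x * f x) := by
  intro φ hφ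
  have h1 := h _ (hφ.smooth_mul hc)
  have i1 := hf'.integrableOn_mul_test hp (hφ.smooth_mul hc)
  have i2 := hf.integrableOn_mul_test hp (hφ.smooth_mul (contDiff_dvf hZ hc))
  have i3 := hf.integrableOn_mul_test hp ((hφ.dvf hZ).smooth_mul hc)
  have e1 : ∫ x in Ω, (c x * f' x + Dvf Z c x * f x) * φ x =
      (∫ x in Ω, f' x * (c x * φ x)) + ∫ x in Ω, f x * (Dvf Z c x * φ x) := by
    rw [← integral_add i1 i2]
    congr 1; ext x; ring
  have e2 : ∫ x in Ω, f x * Dvf Z (fun y => c y * φ y) x =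
      (∫ x in Ω, f x * (c x * Dvf Z φ x)) + ∫ x in Ω, f x * (Dvf Z c x * φ x) := by
    rw [← integral_add i3 i2]
    congr 1; ext x; rw [dvf_mul Z hc hφ.1]; ring
  have e3 : ∫ x in Ω, c x * f x * Dvf Z φ x = ∫ x in Ω, f x * (c x * Dvf Z φ x) := by
    congr 1; ext x; ring
  rw [e1, e3, h1, e2]
  ring

theorem IsWeakDerivVF.add (hp : 1 ≤ p) {Z : CSpace n → CSpace n}
    (hZ : ContDiff ℝ (⊤ : ℕ∞) Z) {f₁ f₂ f₁' f₂' : CSpace n → ℝ}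
    (hf₁ : MemLploc p Ω f₁) (hf₂ : MemLploc p Ω f₂)
    (hf₁' : MemLploc p Ω f₁') (hf₂' : MemLploc p Ω f₂')
    (h₁ : IsWeakDerivVF Ω Z f₁ f₁') (h₂ : IsWeakDerivVF Ω Z f₂ f₂') :
    IsWeakDerivVF Ω Z (fun x => f₁ x + f₂ x) (fun x => f₁' x + f₂' x) := by
  intro φ hφ
  simp only [add_mul]
  rw [integral_add (hf₁'.integrableOn_mul_test hp hφ) (hf₂'.integrableOn_mul_test hp hφ),
    integral_add (hf₁.integrableOn_mul_test hp (hφ.dvf hZ))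
      (hf₂.integrableOn_mul_test hp (hφ.dvf hZ)), h₁ φ hφ, h₂ φ hφ]
  ring

theorem PreservesVF.of_generators (hp : 1 ≤ p) (hS : ∀ f ∈ S, MemLploc p Ω f)
    {Z : CSpace n → CSpace n} (hZ : ContDiff ℝ (⊤ : ℕ∞) Z)
    (h : ∀ f ∈ S, ∃ f' ∈ S, IsWeakDerivVF Ω Z f f') : PreservesVF Ω (SmoothSpan S) Z := by
  refine ⟨hZ, fun f hf => ?_⟩
  induction hf with
  | mem f hf =>
    obtain ⟨f', hf', hw⟩ := h f hf
    exact ⟨f', .mem _ hf', hw⟩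
  | add f₁ f₂ hf₁ hf₂ ih₁ ih₂ =>
    obtain ⟨f₁', h₁, w₁⟩ := ih₁
    obtain ⟨f₂', h₂, w₂⟩ := ih₂
    exact ⟨_, .add _ _ h₁ h₂, w₁.add hp hZ (hf₁.memLploc hS) (hf₂.memLploc hS)
      (h₁.memLploc hS) (h₂.memLploc hS) w₂⟩
  | mul c f hc hf ih =>
    obtain ⟨f', hf', w⟩ := ih
    exact ⟨_, .add _ _ (.mul c f' hc hf') (.mul _ f (contDiff_dvf hZ hc) hf),
      w.smooth_mul hp hZ hc (hf.memLploc hS) (hf'.memLploc hS)⟩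

theorem PreservesVF.zero : PreservesVF Ω (SmoothSpan S) 0 :=
  ⟨contDiff_const, fun f hf => ⟨_, hf.zero_mul, fun φ _ => by simp [Dvf]⟩⟩

theorem PreservesVF.add (hp : 1 ≤ p) (hS : ∀ f ∈ S, MemLploc p Ω f)
    {Z W : CSpace n → CSpace n} (hZ : PreservesVF Ω (SmoothSpan S) Z)
    (hW : PreservesVF Ω (SmoothSpan S) W) : PreservesVF Ω (SmoothSpan S) (Z + W) := by
  refine ⟨hZ.1.add hW.1, fun f hf => ?_⟩
  obtain ⟨f₁, h₁, w₁⟩ := hZ.2 f hf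
  obtain ⟨f₂, h₂, w₂⟩ := hW.2 f hf
  refine ⟨_, .add _ _ h₁ h₂, fun φ hφ => ?_⟩
  have e : ∫ x in Ω, f x * Dvf (Z + W) φ x =
      (∫ x in Ω, f x * Dvf Z φ x) + ∫ x in Ω, f x * Dvf W φ x := by
    rw [← integral_add ((hf.memLploc hS).integrableOn_mul_test hp (hφ.dvf hZ.1))
      ((hf.memLploc hS).integrableOn_mul_test hp (hφ.dvf hW.1))]
    congr 1; ext x; simp [Dvf, mul_add]
  simp only [add_mul]
  rw [integral_add ((h₁.memLploc hS).integrableOn_mul_test hp hφ)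
    ((h₂.memLploc hS).integrableOn_mul_test hp hφ), w₁ φ hφ, w₂ φ hφ, e]
  ring

theorem PreservesVF.smooth_smul {Z : CSpace n → CSpace n}
    (hZ : PreservesVF Ω (SmoothSpan S) Z) {a : CSpace n → ℝ}
    (ha : ContDiff ℝ (⊤ : ℕ∞) a) : PreservesVF Ω (SmoothSpan S) (fun x => a x • Z x) := by
  refine ⟨ha.smul hZ.1, fun f hf => ?_⟩
  obtain ⟨f', hf', w⟩ := hZ.2 _ (SmoothSpan.mul a f ha hf)
  refine ⟨f', hf', fun φ hφ => ?_⟩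
  rw [w φ hφ]
  congr 2; ext x; simp [Dvf]; ring

theorem PreservesVF.sum (hp : 1 ≤ p) (hS : ∀ f ∈ S, MemLploc p Ω f) {ι : Type*}
    (s : Finset ι) (Z : ι → CSpace n → CSpace n)
    (hZ : ∀ i ∈ s, PreservesVF Ω (SmoothSpan S) (Z i)) :
    PreservesVF Ω (SmoothSpan S) (∑ i ∈ s, Z i) :=
  Finset.sum_induction Z _ (fun _ _ h₁ h₂ => h₁.add hp hS h₂) PreservesVF.zero hZ

theorem PreservesVF.of_mem_span (hp : 1 ≤ p) (hS : ∀ f ∈ S, MemLploc p Ω f)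
    {A : Set (CSpace n → CSpace n)} (hA : ∀ Z ∈ A, PreservesVF Ω (SmoothSpan S) Z)
    {Z : CSpace n → CSpace n} (hZ : Z ∈ Submodule.span ℝ A) :
    PreservesVF Ω (SmoothSpan S) Z := by
  induction hZ using Submodule.span_induction with
  | mem Z h => exact hA Z h
  | zero => exact PreservesVF.zero
  | add _ _ _ _ h₁ h₂ => exact h₁.add hp hS h₂
  | smul a _ _ h => exact h.smooth_smul (contDiff_const (c := a))

theorem PreservesVF.vbracket (hp : 1 ≤ p) (hS : ∀ f ∈ S, MemLploc p Ω f)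
    {Z W : CSpace n → CSpace n} (hZ : PreservesVF Ω (SmoothSpan S) Z)
    (hW : PreservesVF Ω (SmoothSpan S) W) :
    PreservesVF Ω (SmoothSpan S) (vbracket Z W) := by
  have hbr : ContDiff ℝ (⊤ : ℕ∞) (_root_.vbracket Z W) :=
    ((hW.1.fderiv_right (by simp)).clm_apply hZ.1).sub
      ((hZ.1.fderiv_right (by simp)).clm_apply hW.1)
  refine ⟨hbr, fun f hf => ?_⟩
  obtain ⟨fz, hfz, wz⟩ := hZ.2 f hf
  obtain ⟨fw, hfw, ww⟩ := hW.2 f hf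
  obtain ⟨fzw, hfzw, wzw⟩ := hW.2 fz hfz
  obtain ⟨fwz, hfwz, wwz⟩ := hZ.2 fw hfw
  refine ⟨_, .add _ _ hfwz (.mul (fun _ => -1) fzw contDiff_const hfzw), fun φ hφ => ?_⟩
  have e : ∫ x in Ω, f x * Dvf (_root_.vbracket Z W) φ x =
      (∫ x in Ω, f x * Dvf Z (Dvf W φ) x) - ∫ x in Ω, f x * Dvf W (Dvf Z φ) x := by
    rw [← integral_sub
      ((hf.memLploc hS).integrableOn_mul_test hp ((hφ.dvf hW.1).dvf hZ.1))
      ((hf.memLploc hS).integrableOn_mul_test hp ((hφ.dvf hZ.1).dvf hW.1))]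
    congr 1; ext x; rw [dvf_vbracket hZ.1 hW.1 hφ.1]; ring
  have e' : ∫ x in Ω, (fwz x + -1 * fzw x) * φ x =
      (∫ x in Ω, fwz x * φ x) - ∫ x in Ω, fzw x * φ x := by
    rw [← integral_sub ((hfwz.memLploc hS).integrableOn_mul_test hp hφ)
      ((hfzw.memLploc hS).integrableOn_mul_test hp hφ)]
    congr 1; ext x; ring
  rw [e', e, wwz φ hφ, wzw φ hφ, ww _ (hφ.dvf hZ.1), wz _ (hφ.dvf hW.1)]
  ring

end Preserves

namespace CarnotGroup

variable {r n : ℕ} (G : CarnotGroup r n)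

theorem mul_inv' (a : CSpace n) : G.mul a (G.inv a) = G.one := by
  calc G.mul a (G.inv a)
      = G.mul (G.mul (G.inv (G.inv a)) (G.inv a)) (G.mul a (G.inv a)) := by
        rw [G.inv_mul', G.one_mul']
    _ = G.mul (G.inv (G.inv a)) (G.mul (G.mul (G.inv a) a) (G.inv a)) := by
        simp only [G.mul_assoc']
    _ = G.one := by rw [G.inv_mul', G.one_mul', G.inv_mul']

theorem differentiable_mul (a : CSpace n) : Differentiable ℝ (G.mul a) :=
  (G.smooth_mul.comp (contDiff_const.prodMk contDiff_id)).differentiable (by simp)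

/-- The value at the identity of the left-invariant field whose value at `x` is `v`. -/
def pullback (v x : CSpace n) : CSpace n := fderiv ℝ (G.mul (G.inv x)) x v

theorem contDiff_pullback (v : CSpace n) : ContDiff ℝ (⊤ : ℕ∞) (G.pullback v) := by
  have h : ContDiff ℝ (⊤ : ℕ∞)
      (Function.uncurry fun x q : CSpace n => G.mul (G.inv x) q) :=
    G.smooth_mul.comp ((G.smooth_inv.comp contDiff_fst).prodMk contDiff_snd)
  exact (h.fderiv contDiff_id (by simp)).clm_apply contDiff_const

theorem fderiv_mul_pullback (v x : CSpace n) :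
    fderiv ℝ (G.mul x) G.one (G.pullback v x) = v := by
  have hc : (G.mul x) ∘ (G.mul (G.inv x)) = id := by
    ext1 q
    simp [← G.mul_assoc', G.mul_inv', G.one_mul']
  have h := fderiv_comp x (G.differentiable_mul x (G.mul (G.inv x) x))
    (G.differentiable_mul (G.inv x) x)
  rw [hc, G.inv_mul', fderiv_id] at h
  simpa [pullback] using (congrArg (fun T : CSpace n →L[ℝ] CSpace n => T v) h).symm

theorem X_eq (k : ℕ) (i : Fin (G.m k)) (x : CSpace n) :
    G.X k i x = fderiv ℝ (G.mul x) G.one (G.X k i G.one) := by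
  simpa [G.mul_one'] using G.left_invariant_X k i x G.one

/-- Constant vector fields are combinations, with smooth coefficients, of the left-invariant
basis. -/
theorem exists_smooth_coeff (v : CSpace n) :
    ∃ a : ((k : Fin (r + 1)) × Fin (G.m k.1)) → CSpace n → ℝ,
      (∀ z, ContDiff ℝ (⊤ : ℕ∞) (a z)) ∧
        (fun _ => v) = ∑ z, fun x => a z x • G.X z.1 z.2 x := by
  have hcard : Fintype.card ((k : Fin (r + 1)) × Fin (G.m k.1)) =
      Module.finrank ℝ (CSpace n) := by
    simp only [Fintype.card_sigma, Fintype.card_fin, finrank_euclideanSpace]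
    rw [Fin.sum_univ_eq_sum_range (fun k => G.m k) (r + 1), G.dim_eq]
  let b := Module.Basis.mk G.indep_X
    (G.indep_X.span_eq_top_of_card_eq_finrank' hcard).ge
  refine ⟨fun z x => b.coord z (G.pullback v x), fun z => ?_, ?_⟩
  · exact (LinearMap.toContinuousLinearMap (b.coord z)).contDiff.comp (G.contDiff_pullback v)
  · ext1 x
    have h := G.fderiv_mul_pullback v x
    rw [← b.sum_repr (G.pullback v x), map_sum] at h
    rw [Finset.sum_apply]
    refine h.symm.trans ?_
    refine Finset.sum_congr rfl fun z _ => ?_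
    rw [G.X_eq z.1 z.2 x, map_smul, Module.Basis.mk_apply]
    rfl

theorem preservesVF_X {p : ℝ≥0∞} {Ω : Set (CSpace n)} {S : Set (CSpace n → ℝ)}
    (hp : 1 ≤ p) (hS : ∀ f ∈ S, MemLploc p Ω f)
    (h : ∀ i, PreservesVF Ω (SmoothSpan S) (G.X 1 i)) (k : ℕ) (i : Fin (G.m k)) :
    PreservesVF Ω (SmoothSpan S) (G.X k i) := by
  induction k with
  | zero => exact (Fin.cast (G.m_zero 0 (.inl rfl)) i).elim0
  | succ k ih =>
    rcases Nat.eq_zero_or_pos k with rfl | hk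
    · exact h i
    · by_cases hkr : k < r
      · refine PreservesVF.of_mem_span hp hS ?_
          (G.bracket_span k hk hkr (Submodule.subset_span ⟨i, rfl⟩))
        rintro _ ⟨z, rfl⟩
        exact (h z.1).vbracket hp hS (ih z.2)
      · exact (Fin.cast (G.m_zero (k + 1) (.inr (by omega))) i).elim0

theorem preservesVF_const {p : ℝ≥0∞} {Ω : Set (CSpace n)} {S : Set (CSpace n → ℝ)}
    (hp : 1 ≤ p) (hS : ∀ f ∈ S, MemLploc p Ω f)
    (h : ∀ i, PreservesVF Ω (SmoothSpan S) (G.X 1 i)) (v : CSpace n) :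
    PreservesVF Ω (SmoothSpan S) (fun _ => v) := by
  obtain ⟨a, ha, hv⟩ := G.exists_smooth_coeff v
  rw [hv]
  exact PreservesVF.sum hp hS _ _ fun z _ =>
    (G.preservesVF_X hp hS h z.1 z.2).smooth_smul (ha z)

end CarnotGroup

/-- **Horizontal Sobolev spaces embed in Euclidean Sobolev spaces.** Let `G` be
a Carnot group of step `r` (identified with `ℝⁿ` via exponential coordinates),
`Ω ⊆ G` open and `1 ≤ p ≤ ∞`.  If `u : Ω → ℝ^N` belongs to the horizontal
Sobolev space `S^{k,p}_{loc}(Ω)` for every `k ∈ ℕ` (i.e. all iterated weak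
horizontal derivatives of `u`, recorded by the family `g` indexed by strings of
horizontal directions, lie in `L^p_{loc}(Ω)`), then `u` belongs to the
Euclidean Sobolev space `W^{k,p}_{loc}(Ω)` for every `k ∈ ℕ` (i.e. all iterated
weak coordinate derivatives of `u` exist and lie in `L^p_{loc}(Ω)`). -/
theorem horizontal_sobolev_subset_euclidean_sobolev {r n N : ℕ}
    (G : CarnotGroup r n) (Ω : Set (CSpace n)) (hΩ : IsOpen Ω)
    (p : ℝ≥0∞) (hp : 1 ≤ p)
    (u : Fin N → CSpace n → ℝ)
    (g : List (Fin (G.m 1)) → Fin N → CSpace n → ℝ)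
    (hg0 : g [] = u)
    (hgd : ∀ (L : List (Fin (G.m 1))) (i : Fin (G.m 1)) (β : Fin N),
      IsWeakDerivVF Ω (G.X 1 i) (g L β) (g (L ++ [i]) β))
    (hgl : ∀ L β, MemLploc p Ω (g L β)) :
    ∃ h : List (Fin n) → Fin N → CSpace n → ℝ,
      h [] = u ∧
      (∀ (L : List (Fin n)) (d : Fin n) (β : Fin N),
        IsWeakDerivVF Ω (fun _ => EuclideanSpace.single d (1 : ℝ))
          (h L β) (h (L ++ [d]) β)) ∧
      ∀ L β, MemLploc p Ω (h L β) := by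
  let S : Fin N → Set (CSpace n → ℝ) := fun β => Set.range fun L => g L β
  have hS : ∀ β, ∀ f ∈ S β, MemLploc p Ω f := by
    rintro β _ ⟨L, rfl⟩
    exact hgl L β
  have hX : ∀ β i, PreservesVF Ω (SmoothSpan (S β)) (G.X 1 i) := fun β i => by
    refine PreservesVF.of_generators hp (hS β) (G.smooth_X 1 i) ?_
    rintro _ ⟨L, rfl⟩
    exact ⟨_, ⟨L ++ [i], rfl⟩, hgd L i β⟩
  have hE := fun β (d : Fin n) =>
    (G.preservesVF_const hp (hS β) (hX β) (EuclideanSpace.single d 1)).2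
  choose D hD hDw using hE
  let step : (β : Fin N) → Subtype (SmoothSpan (S β)) → Fin n → Subtype (SmoothSpan (S β)) :=
    fun β f d => ⟨D β d f.1 f.2, hD β d f.1 f.2⟩
  have hu : ∀ β, SmoothSpan (S β) (u β) := fun β => .mem _ ⟨[], congrFun hg0 β⟩
  refine ⟨fun L β => (L.foldl (step β) ⟨u β, hu β⟩).1, rfl, fun L d β => ?_,
    fun L β => (L.foldl (step β) ⟨u β, hu β⟩).2.memLploc (hS β)⟩
  simp only [List.foldl_append, List.foldl_cons, List.foldl_nil]
  exact hDw β d _ _
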